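/- arXiv:2503.17211 — 3 statements merged into one kernel-verified Lean document; each statement's English description precedes it below -/
import Mathlib

section
/- Let N ≥ 1 and let L : Fin N → ℝ be the alignment costs. Suppose the index set splits into a nonempty set G of clean samples, each achieving the minimal cost m = min_i L i, with |G| = k ≥ 1, and a set of corrupted samples whose costs satisfy L j ≥ m + δ with δ > 0. For τ > 0 let w_i(τ) = exp(−τ·L i) / Σ_{j=1}^{N} exp(−τ·L j) be the softmax weights. Then the total weight on the clean samples satisfies the lower bound Σ_{i ∈ G} w_i(τ) ≥ k / (k + (N − k)·exp(−τ·δ)). -/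
/-- If a nonempty set `G` of clean samples all achieve the minimal cost
`m = min_i L i` (with `k = |G| ≥ 1`), and every other (corrupted) sample `j ∉ G`
satisfies `L j ≥ m + δ` with `δ > 0`, then the total softmax weight on the clean
samples is at least `k / (k + (N - k) · exp(-τ δ))`. -/
theorem a3w_clean_total_weight_lower_bound (N : ℕ) (hN : 1 ≤ N) (L : Fin N → ℝ) (m : ℝ)
    (hm : IsLeast (Set.range L) m) (δ : ℝ) (hδ : 0 < δ)
    (G : Finset (Fin N)) (hG : G.Nonempty)
    (hclean : ∀ i ∈ G, L i = m) (hcorr : ∀ j ∉ G, m + δ ≤ L j)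
    (τ : ℝ) (hτ : 0 < τ) :
    (G.card : ℝ) / ((G.card : ℝ) + ((N : ℝ) - (G.card : ℝ)) * Real.exp (-τ * δ))
      ≤ ∑ i ∈ G, Real.exp (-τ * L i) / ∑ j, Real.exp (-τ * L j) := by
  have hk : (0 : ℝ) < G.card := by exact_mod_cast hG.card_pos
  have hcompl : ((Gᶜ.card : ℕ) : ℝ) = (N : ℝ) - G.card := by
    rw [Finset.card_compl, Fintype.card_fin,
      Nat.cast_sub (by simpa using Finset.card_le_univ G)]
  have hclean_sum : ∑ i ∈ G, Real.exp (-τ * L i) = G.card * Real.exp (-τ * m) := by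
    rw [Finset.sum_congr rfl fun i hi => by rw [hclean i hi], Finset.sum_const, nsmul_eq_mul]
  have hcorr_sum : ∑ j ∈ Gᶜ, Real.exp (-τ * L j) ≤
      ((N : ℝ) - G.card) * (Real.exp (-τ * m) * Real.exp (-τ * δ)) := by
    rw [← hcompl, ← nsmul_eq_mul]
    refine Finset.sum_le_card_nsmul _ _ _ fun j hj => ?_
    rw [← Real.exp_add, Real.exp_le_exp]
    nlinarith [hcorr j (Finset.mem_compl.mp hj)]
  have hden : 0 < (G.card : ℝ) + ((N : ℝ) - G.card) * Real.exp (-τ * δ) := by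
    rw [← hcompl]
    positivity
  have hE := Real.exp_pos (-τ * m)
  have htotal_pos : 0 < ∑ j, Real.exp (-τ * L j) :=
    Finset.sum_pos (fun j _ => Real.exp_pos _) (hG.mono (Finset.subset_univ G))
  rw [← Finset.sum_div, div_le_div_iff₀ hden htotal_pos, hclean_sum, mul_assoc]
  refine mul_le_mul_of_nonneg_left ?_ hk.le
  rw [← Finset.sum_add_sum_compl G, hclean_sum]
  linarith
end

section
/- Let N ≥ 1, let L : Fin N → ℝ be the alignment costs with minimum m = min_i L i achieved on the set S = {i | L i = m}, and let ℓ : Fin N → ℝ be arbitrary per-sample losses (e.g. cross-entropy values). For τ > 0 let w_i(τ) = exp(−τ·L i) / Σ_{j=1}^{N} exp(−τ·L j) be the softmax weights. Then the weighted empirical risk converges, as the temperature grows, to the average loss over the minimal-cost (clean) samples: lim_{τ → ∞} Σ_{i=1}^{N} w_i(τ)·ℓ i = (1/|S|) · Σ_{i ∈ S} ℓ i. -/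
/-- Exponentials of a nonnegative gap, at growing inverse scale, tend to the indicator that
the gap vanishes. -/
theorem tendsto_exp_neg_mul_gap {a m : ℝ} (h : m ≤ a) :
    Filter.Tendsto (fun τ : ℝ => Real.exp (-τ * (a - m))) Filter.atTop
      (nhds (if a = m then 1 else 0)) := by
  split_ifs with ha
  · simp [ha]
  · have hpos : 0 < a - m := sub_pos.mpr (lt_of_le_of_ne h (Ne.symm ha))
    refine Real.tendsto_exp_atBot.comp ?_
    simpa [Function.comp_def] using
      Filter.tendsto_neg_atTop_atBot.comp (Filter.tendsto_id.atTop_mul_const hpos)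

/-- Softmax weights are invariant under a common shift of the costs. -/
theorem softmax_sub_const {ι : Type*} [Fintype ι] (L : ι → ℝ) (m τ : ℝ) (i : ι) :
    Real.exp (-τ * (L i - m)) / ∑ j, Real.exp (-τ * (L j - m)) =
      Real.exp (-τ * L i) / ∑ j, Real.exp (-τ * L j) := by
  have h (j : ι) : Real.exp (-τ * (L j - m)) = Real.exp (-τ * L j) * Real.exp (τ * m) := by
    rw [← Real.exp_add]
    ring_nf
  simp only [h, ← Finset.sum_mul]
  exact mul_div_mul_right _ _ (Real.exp_ne_zero _)

/-- The weighted empirical risk `∑_i w_i(τ) · ℓ i` with softmax weights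
`w_i(τ) = exp(-τ L i) / ∑_j exp(-τ L j)` converges as τ → ∞ to the average loss over
the minimal-cost samples `S = {i | L i = m}`, i.e. `(1/|S|) ∑_{i ∈ S} ℓ i`. -/
theorem a3w_weighted_risk_tendsto_clean_risk (N : ℕ) (hN : 1 ≤ N)
    (L : Fin N → ℝ) (ℓ : Fin N → ℝ) (m : ℝ) (hm : IsLeast (Set.range L) m) :
    Filter.Tendsto
      (fun τ : ℝ =>
        ∑ i, (Real.exp (-τ * L i) / ∑ j, Real.exp (-τ * L j)) * ℓ i)
      Filter.atTop
      (nhds ((1 / ((Finset.univ.filter (fun i => L i = m)).card : ℝ)) *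
        ∑ i ∈ Finset.univ.filter (fun i => L i = m), ℓ i)) := by
  obtain ⟨⟨i₀, hi₀⟩, hle⟩ := hm
  have hexp (i : Fin N) := tendsto_exp_neg_mul_gap (hle (Set.mem_range_self i))
  have hcard : ((Finset.univ.filter (fun i => L i = m)).card : ℝ) ≠ 0 :=
    Nat.cast_ne_zero.mpr (Finset.card_ne_zero_of_mem (a := i₀) (by simp [hi₀]))
  have hden : Filter.Tendsto (fun τ : ℝ => ∑ j, Real.exp (-τ * (L j - m))) Filter.atTop
      (nhds ((Finset.univ.filter (fun i => L i = m)).card : ℝ)) := by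
    simpa only [Finset.sum_boole] using tendsto_finsetSum Finset.univ fun j _ => hexp j
  have hlim := tendsto_finsetSum Finset.univ fun i _ =>
    ((hexp i).div hden hcard).mul_const (ℓ i)
  simp only [Pi.div_apply, softmax_sub_const] at hlim
  convert hlim using 2
  rw [Finset.mul_sum, Finset.sum_filter]
  refine Finset.sum_congr rfl fun i _ => ?_
  split_ifs <;> simp
end

section
/- Let N ≥ 1 and let L : Fin N → ℝ be the alignment costs, and suppose index i₀ achieves the minimal cost, L i₀ = min_j L j. For τ > 0 let w_i(τ) = exp(−τ·L i) / Σ_{j=1}^{N} exp(−τ·L j) be the softmax weights. Then the weight of the minimizer is monotone nondecreasing in the temperature: for all 0 < τ₁ ≤ τ₂, w_{i₀}(τ₁) ≤ w_{i₀}(τ₂). -/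
/-- If `i₀` achieves the minimal alignment cost, then its softmax weight
is monotone nondecreasing in the temperature: for `0 < τ₁ ≤ τ₂`,
`w_{i₀}(τ₁) ≤ w_{i₀}(τ₂)`. -/
theorem a3w_minimizer_weight_monotone (N : ℕ) (hN : 1 ≤ N) (L : Fin N → ℝ)
    (i₀ : Fin N) (hi₀ : ∀ j, L i₀ ≤ L j)
    (τ₁ τ₂ : ℝ) (hτ₁ : 0 < τ₁) (hτ : τ₁ ≤ τ₂) :
    Real.exp (-τ₁ * L i₀) / ∑ j, Real.exp (-τ₁ * L j)
      ≤ Real.exp (-τ₂ * L i₀) / ∑ j, Real.exp (-τ₂ * L j) := by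
  have hpos (τ : ℝ) : 0 < ∑ j, Real.exp (-τ * L j) :=
    Finset.sum_pos (fun _ _ => Real.exp_pos _) ⟨i₀, Finset.mem_univ _⟩
  rw [div_le_div_iff₀ (hpos τ₁) (hpos τ₂), Finset.mul_sum, Finset.mul_sum]
  refine Finset.sum_le_sum fun j _ => ?_
  rw [← Real.exp_add, ← Real.exp_add, Real.exp_le_exp]
  nlinarith [mul_nonneg (sub_nonneg.2 hτ) (sub_nonneg.2 (hi₀ j))]
end
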